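/- arXiv:2211.08123 — 2 statements merged into one kernel-verified Lean document; each statement's English description precedes it below -/
import Mathlib

section
/- Let G be a finite group and χ an irreducible complex character of G such that χ(1) divides ψ(1) for every irreducible complex character ψ of G with ψ(1) > 1. Then χ(1) divides the number of linear characters λ of G (irreducible characters of degree 1) satisfying λ·χ = χ. -/
open scoped ComplexOrder

noncomputable section

/-- `χ : G → ℂ` is an irreducible character: the character of a simple
finite-dimensional complex representation of `G`. -/
def IsIrrChar (G : Type) [Group G] (χ : G → ℂ) : Prop :=
  ∃ V : FDRep ℂ G, CategoryTheory.Simple V ∧ χ = V.character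

/-- A virtual character is a `ℤ`-linear combination of irreducible characters. -/
def IsVirtualChar (G : Type) [Group G] (χ : G → ℂ) : Prop :=
  χ ∈ Submodule.span ℤ {f : G → ℂ | IsIrrChar G f}

open Classical in
/-- The regular character: `|G|` at the identity, `0` elsewhere. -/
def regChar (G : Type) [Group G] : G → ℂ :=
  fun g => if g = 1 then (Nat.card G : ℂ) else 0

/-- The Knutson index of `χ`: the least positive `n` such that `χ·φ = n·ρ_reg`
for some virtual character `φ`. -/
def KnutsonIndex (G : Type) [Group G] (χ : G → ℂ) : ℕ :=
  sInf {n : ℕ | 0 < n ∧ ∃ φ : G → ℂ, IsVirtualChar G φ ∧ χ * φ = n • regChar G}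

/-- `ℂ[G]` is of Knutson type: every irreducible character is regular invertible. -/
def IsKnutsonType (G : Type) [Group G] : Prop :=
  ∀ χ : G → ℂ, IsIrrChar G χ → ∃ φ : G → ℂ, IsVirtualChar G φ ∧ χ * φ = regChar G

/-- Savitskii's preorder: `φ ≤ χ` iff `φ(1) ≤ χ(1)` and every zero of `χ` is a zero of `φ`. -/
def SavitskiiLE (G : Type) [Group G] (φ χ : G → ℂ) : Prop :=
  φ 1 ≤ χ 1 ∧ ∀ g : G, χ g = 0 → φ g = 0

/-- A virtual character of positive degree is Savitskii-minimal if every virtual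
character of positive degree below it is also above it. -/
def SavitskiiMinimal (G : Type) [Group G] (χ : G → ℂ) : Prop :=
  ∀ φ : G → ℂ, IsVirtualChar G φ → 0 < φ 1 → SavitskiiLE G φ χ → SavitskiiLE G χ φ

end

open CategoryTheory MonoidalCategory Module

/-- The trace is multiplicative on endomorphisms of a one-dimensional space. -/
theorem trace_mul_of_finrank_eq_one {k V : Type*} [Field k] [AddCommGroup V] [Module k V]
    (h : finrank k V = 1) (f g : V →ₗ[k] V) :
    LinearMap.trace k V (f * g) = LinearMap.trace k V f * LinearMap.trace k V g := by
  obtain ⟨a, rfl, -⟩ := f.existsUnique_eq_smul_id_of_finrank_eq_one h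
  have : FiniteDimensional k V := Module.finite_of_finrank_eq_succ h
  have h1 : LinearMap.trace k V 1 = 1 := by rw [LinearMap.trace_one, h, Nat.cast_one]
  simp [← Module.End.one_eq_id, h1]

/-- The trace of an endomorphism preserving two complementary submodules is the sum of the traces
of its restrictions. -/
theorem trace_eq_add_trace_restrict_of_isCompl {k V : Type*} [Field k] [AddCommGroup V]
    [Module k V] [FiniteDimensional k V] {p q : Submodule k V} (h : IsCompl p q) (f : V →ₗ[k] V)
    (hp : ∀ x ∈ p, f x ∈ p) (hq : ∀ x ∈ q, f x ∈ q) :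
    LinearMap.trace k V f =
      LinearMap.trace k p (f.restrict hp) + LinearMap.trace k q (f.restrict hq) := by
  rw [← LinearMap.trace_prodMap', ← LinearMap.trace_conj' _ (p.prodEquivOfIsCompl q h)]
  congr 1
  ext x
  obtain ⟨y, rfl⟩ := (p.prodEquivOfIsCompl q h).surjective x
  simp [LinearEquiv.conj_apply]

section Characters

variable {G : Type} [Group G]

theorem isIrrChar_of_isIrreducible [Finite G] {V : Type} [AddCommGroup V] [Module ℂ V]
    [FiniteDimensional ℂ V] (ρ : Representation ℂ G V) [ρ.IsIrreducible] :
    IsIrrChar G ρ.character := by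
  have := Fintype.ofFinite G
  have := invertibleOfNonzero (NeZero.ne (Nat.card G : ℂ))
  refine ⟨FDRep.of ρ, ?_, rfl⟩
  rw [FDRep.simple_iff_char_is_norm_one]
  have h := Representation.char_orthonormal ρ ρ
  rw [if_pos ⟨Representation.Equiv.refl ρ⟩, inv_mul_eq_one₀ (NeZero.ne _)] at h
  exact h.symm

/-- Every character of a finite group is a sum of irreducible characters. -/
theorem exists_character_eq_sum_isIrrChar [Finite G] {V : Type} [AddCommGroup V] [Module ℂ V]
    [FiniteDimensional ℂ V] (ρ : Representation ℂ G V) :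
    ∃ s : Multiset (G → ℂ), (∀ ψ ∈ s, IsIrrChar G ψ) ∧ ρ.character = s.sum := by
  induction hn : finrank ℂ V using Nat.strong_induction_on generalizing V with
  | _ n ih =>
  subst hn
  by_cases hirr : ρ.IsIrreducible
  · exact ⟨{ρ.character}, by simpa using isIrrChar_of_isIrreducible ρ, by simp⟩
  by_cases hV : Subsingleton V
  · refine ⟨0, by simp, ?_⟩
    ext g
    simp [Representation.character, Subsingleton.elim (ρ g) 0]
  have hex : ∃ σ : Subrepresentation ρ, σ ≠ ⊥ ∧ σ ≠ ⊤ := by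
    by_contra! h
    have hne : (⊥ : Subrepresentation ρ) ≠ ⊤ := fun he ↦ hV <| by
      have := congrArg Subrepresentation.toSubmodule he
      exact (Submodule.subsingleton_iff ℂ).mp (subsingleton_of_bot_eq_top this)
    have : Nontrivial (Subrepresentation ρ) := ⟨_, _, hne⟩
    exact hirr ⟨fun σ ↦ or_iff_not_imp_left.mpr (h σ)⟩
  obtain ⟨σ, hbot, htop⟩ := hex
  obtain ⟨τ, hστ⟩ := exists_isCompl σ
  have hc : IsCompl σ.toSubmodule τ.toSubmodule := by
    rw [isCompl_iff, disjoint_iff, codisjoint_iff]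
    exact ⟨congrArg Subrepresentation.toSubmodule hστ.inf_eq_bot,
      congrArg Subrepresentation.toSubmodule hστ.sup_eq_top⟩
  have hσ : σ.toSubmodule ≠ ⊤ := fun h ↦ htop (Subrepresentation.toSubmodule_injective h)
  have hτ : τ.toSubmodule ≠ ⊤ := fun h ↦ hbot <| Subrepresentation.toSubmodule_injective <|
    eq_bot_of_isCompl_top (h ▸ hc)
  obtain ⟨s, hs, hs'⟩ := ih _ (Submodule.finrank_lt hσ) σ.toRepresentation rfl
  obtain ⟨t, ht, ht'⟩ := ih _ (Submodule.finrank_lt hτ) τ.toRepresentation rfl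
  refine ⟨s + t, fun ψ hψ ↦ (Multiset.mem_add.mp hψ).elim (hs ψ) (ht ψ), ?_⟩
  rw [Multiset.sum_add, ← hs', ← ht']
  ext g
  exact trace_eq_add_trace_restrict_of_isCompl hc (ρ g)
    (fun _ h ↦ σ.apply_mem_toSubmodule g h) fun _ h ↦ τ.apply_mem_toSubmodule g h

/-- The bilinear pairing `|G|⁻¹ ∑ f(g) ψ(g⁻¹)` with a fixed function `ψ`, as a map of `f`. -/
noncomputable def charPairing [Fintype G] (ψ : G → ℂ) : (G → ℂ) →+ ℂ where
  toFun f := (Nat.card G : ℂ)⁻¹ * ∑ g, f g * ψ g⁻¹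
  map_zero' := by simp
  map_add' f f' := by simp [add_mul, Finset.sum_add_distrib, mul_add]

open Classical in
theorem charPairing_of_isIrrChar [Fintype G] {χ ψ : G → ℂ} (hχ : IsIrrChar G χ)
    (hψ : IsIrrChar G ψ) : charPairing ψ χ = if ψ = χ then 1 else 0 := by
  have := invertibleOfNonzero (NeZero.ne (Nat.card G : ℂ))
  obtain ⟨V, hV, rfl⟩ := hχ
  obtain ⟨W, hW, rfl⟩ := hψ
  have h := FDRep.char_orthonormal V W
  have hself := FDRep.char_orthonormal V V
  rw [if_pos ⟨Iso.refl V⟩] at hself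
  by_cases hVW : Nonempty (V ≅ W)
  · rw [if_pos hVW] at h
    rw [if_pos (FDRep.char_iso hVW.some).symm]
    exact h
  · rw [if_neg hVW] at h
    have hne : W.character ≠ V.character := fun he ↦ by
      rw [he, hself] at h
      exact one_ne_zero h
    rw [if_neg hne]
    exact h

open Classical in
/-- The multiplicity of an irreducible character in a sum of irreducible characters is given by
the pairing. -/
theorem charPairing_sum_eq_count [Fintype G] {ψ : G → ℂ} (hψ : IsIrrChar G ψ)
    {s : Multiset (G → ℂ)} (hs : ∀ φ ∈ s, IsIrrChar G φ) :
    charPairing ψ s.sum = s.count ψ := by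
  induction s using Multiset.induction_on with
  | empty => simp
  | cons φ s ih =>
    rw [Multiset.sum_cons, map_add, ih fun φ' h ↦ hs φ' (Multiset.mem_cons_of_mem h),
      charPairing_of_isIrrChar (hs φ (Multiset.mem_cons_self φ s)) hψ, Multiset.count_cons]
    split_ifs <;> simp [add_comm]

/-- The product of a linear character with an irreducible character is irreducible. -/
theorem IsIrrChar.linear_mul [Finite G] {lam χ : G → ℂ} (hlam : IsIrrChar G lam)
    (hone : lam 1 = 1) (hχ : IsIrrChar G χ) : IsIrrChar G (lam * χ) := by
  have := Fintype.ofFinite G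
  obtain ⟨L, -, rfl⟩ := hlam
  obtain ⟨V, hV, rfl⟩ := hχ
  have hdim : finrank ℂ L = 1 := by
    rw [FDRep.char_one] at hone
    exact_mod_cast hone
  have hinv (g : G) : L.character g * L.character g⁻¹ = 1 := by
    have h := trace_mul_of_finrank_eq_one hdim (L.ρ g) (L.ρ g⁻¹)
    rw [← map_mul, mul_inv_cancel] at h
    exact h.symm.trans hone
  refine ⟨L ⊗ V, ?_, (FDRep.char_tensor L V).symm⟩
  rw [FDRep.simple_iff_char_is_norm_one] at hV ⊢
  rw [← hV, FDRep.char_tensor]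
  refine Finset.sum_congr rfl fun g _ ↦ ?_
  rw [Pi.mul_apply, Pi.mul_apply, mul_mul_mul_comm, hinv, one_mul]

open Classical in
/-- If `d` divides the degrees of all nonlinear irreducible characters, then the value at `1` of a
sum of irreducible characters is congruent modulo `d` to its number of linear constituents. -/
theorem exists_sum_apply_one_eq {d : ℕ}
    (hdiv : ∀ ψ : G → ℂ, IsIrrChar G ψ → ∀ m : ℕ, ψ 1 = (m : ℂ) → 1 < m → d ∣ m)
    {s : Multiset (G → ℂ)} (hs : ∀ φ ∈ s, IsIrrChar G φ) :
    ∃ c : ℕ, s.sum 1 = (((s.filter fun φ ↦ φ 1 = 1).card + d * c : ℕ) : ℂ) := by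
  induction s using Multiset.induction_on with
  | empty => exact ⟨0, by simp⟩
  | cons φ s ih =>
    obtain ⟨c, hc⟩ := ih fun φ' h ↦ hs φ' (Multiset.mem_cons_of_mem h)
    have hφ := hs φ (Multiset.mem_cons_self φ s)
    rw [Multiset.sum_cons, Pi.add_apply, hc]
    by_cases h1 : φ 1 = 1
    · refine ⟨c, ?_⟩
      rw [Multiset.filter_cons_of_pos s h1, Multiset.card_cons, h1]
      push_cast
      ring
    · obtain ⟨m, hm⟩ : ∃ m : ℕ, φ 1 = m := by
        obtain ⟨V, -, rfl⟩ := hφ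
        exact ⟨_, FDRep.char_one V⟩
      have hm1 : m ≠ 1 := by
        rintro rfl
        exact h1 (by simpa using hm)
      obtain ⟨e, rfl⟩ : d ∣ m := by
        rcases Nat.eq_zero_or_pos m with rfl | hpos
        · exact dvd_zero d
        · exact hdiv φ hφ m hm (by omega)
      refine ⟨c + e, ?_⟩
      rw [Multiset.filter_cons_of_neg s h1, hm]
      push_cast
      ring

end Characters

/-- If the degree `d` of an irreducible character `χ` of a finite
group divides the degree of every irreducible character of degree `> 1`, then `d`
divides the number of linear characters `λ` with `λ·χ = χ` (the order of the
stabiliser of `χ`). -/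
theorem degree_dvd_stabilizer_card {G : Type} [Group G] [Finite G]
    (χ : G → ℂ) (hχ : IsIrrChar G χ) (d : ℕ) (hd : χ 1 = (d : ℂ))
    (hdiv : ∀ ψ : G → ℂ, IsIrrChar G ψ → ∀ m : ℕ, ψ 1 = (m : ℂ) → 1 < m → d ∣ m) :
    d ∣ Nat.card {lam : G → ℂ // IsIrrChar G lam ∧ lam 1 = 1 ∧ lam * χ = χ} := by
  classical
  have := Fintype.ofFinite G
  obtain ⟨V, hV, hχV⟩ := id hχ
  obtain ⟨s, hs, hsum⟩ := exists_character_eq_sum_isIrrChar (Representation.linHom V.ρ V.ρ)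
  have hval (g : G) : s.sum g = χ g⁻¹ * χ g := by
    rw [← hsum, hχV]
    exact Representation.char_linHom V.ρ V.ρ g
  have hcount (lam : G → ℂ) (hlam : IsIrrChar G lam) (hone : lam 1 = 1) :
      s.count lam = if lam * χ = χ then 1 else 0 := by
    have hpair : charPairing lam s.sum = charPairing (lam * χ) χ := by
      refine congrArg ((Nat.card G : ℂ)⁻¹ * ·) ?_
      refine Finset.sum_congr rfl fun g _ ↦ ?_
      rw [hval, Pi.mul_apply]
      ring
    rw [charPairing_sum_eq_count hlam hs,
      charPairing_of_isIrrChar hχ (hlam.linear_mul hone hχ)] at hpair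
    exact_mod_cast hpair
  set t := s.filter fun φ ↦ φ 1 = 1 with ht
  have hmem (lam : G → ℂ) : lam ∈ t ↔ IsIrrChar G lam ∧ lam 1 = 1 ∧ lam * χ = χ := by
    rw [ht, Multiset.mem_filter]
    constructor
    · rintro ⟨hlam, hone⟩
      refine ⟨hs lam hlam, hone, ?_⟩
      by_contra hne
      have h := hcount lam (hs lam hlam) hone
      rw [if_neg hne, Multiset.count_eq_zero] at h
      exact h hlam
    · rintro ⟨hlam, hone, hfix⟩
      refine ⟨Multiset.count_pos.mp ?_, hone⟩
      rw [hcount lam hlam hone, if_pos hfix]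
      exact one_pos
  have hnodup : t.Nodup := by
    refine Multiset.nodup_iff_count_le_one.mpr fun lam ↦ ?_
    by_cases hlam : lam ∈ t
    · obtain ⟨hirr, hone, hfix⟩ := (hmem lam).mp hlam
      refine (Multiset.count_le_of_le lam (Multiset.filter_le _ s)).trans ?_
      rw [hcount lam hirr hone, if_pos hfix]
    · rw [Multiset.count_eq_zero_of_notMem hlam]
      exact zero_le_one
  have hcard : Nat.card {lam : G → ℂ // IsIrrChar G lam ∧ lam 1 = 1 ∧ lam * χ = χ} = t.card :=
    Nat.subtype_card ⟨t, hnodup⟩ hmem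
  obtain ⟨c, hc⟩ := exists_sum_apply_one_eq hdiv hs
  rw [hval, inv_one, hd] at hc
  have hdd : d * d = t.card + d * c := by exact_mod_cast hc
  rw [hcard, Nat.dvd_add_iff_left (dvd_mul_right d c), ← hdd]
  exact dvd_mul_right d d
end

section
/- Let G be a finite group and suppose there is a positive integer n such that every irreducible complex character of G has degree 1 or degree n. Then ℂ[G] is of Knutson type: every irreducible complex character χ of G admits a virtual character φ with χ·φ = ρ_reg. -/
open scoped ComplexOrder

section Characters

open CategoryTheory Representation

variable {G : Type} [Group G]

/-- The character of a representation is the sum of the characters of two complementary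
subrepresentations. -/
theorem Representation.character_eq_add_of_isCompl {V : Type} [AddCommGroup V] [Module ℂ V]
    [FiniteDimensional ℂ V] {ρ : Representation ℂ G V} {p q : Subrepresentation ρ}
    (hpq : IsCompl p.toSubmodule q.toSubmodule) :
    ρ.character = p.toRepresentation.character + q.toRepresentation.character := by
  ext g
  have e := LinearMap.trace_conj' (LinearMap.prodMap (p.toRepresentation g)
    (q.toRepresentation g)) (Submodule.prodEquivOfIsCompl _ _ hpq)
  rw [LinearMap.trace_prodMap'] at e
  rw [Pi.add_apply, Representation.character, Representation.character, Representation.character,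
    ← e]
  congr 1
  ext v
  obtain ⟨w, rfl⟩ := (Submodule.prodEquivOfIsCompl _ _ hpq).surjective v
  simp [LinearEquiv.conj_apply, Subrepresentation.toRepresentation]

/-- The character of an irreducible representation is an irreducible character. -/
theorem Representation.IsIrreducible.isIrrChar [Finite G] {V : Type} [AddCommGroup V] [Module ℂ V]
    [FiniteDimensional ℂ V] (ρ : Representation ℂ G V) [IsIrreducible ρ] :
    IsIrrChar G ρ.character := by
  have := Fintype.ofFinite G
  have hG : (Nat.card G : ℂ) ≠ 0 := NeZero.ne _
  have := invertibleOfNonzero hG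
  refine ⟨FDRep.of ρ, ?_, rfl⟩
  rw [FDRep.simple_iff_char_is_norm_one]
  have h := card_inv_mul_sum_char_mul_char_eq_finrank ρ ρ
  rw [IsIrreducible.finrank_intertwiningMap_self, Nat.cast_one, inv_mul_eq_one₀ hG] at h
  exact h.symm

/-- The character of a representation is a sum of irreducible characters. -/
theorem Representation.character_mem_closure [Finite G] {V : Type} [AddCommGroup V] [Module ℂ V]
    [FiniteDimensional ℂ V] (ρ : Representation ℂ G V) :
    ρ.character ∈ AddSubmonoid.closure {f : G → ℂ | IsIrrChar G f} := by
  induction hd : Module.finrank ℂ V using Nat.strong_induction_on generalizing V with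
  | _ d ih =>
  subst hd
  by_cases hirr : IsIrreducible ρ
  · exact AddSubmonoid.subset_closure (IsIrreducible.isIrrChar ρ)
  rcases subsingleton_or_nontrivial V with hV | hV
  · have : ρ.character = 0 := by
      ext g
      simp [Representation.character, Subsingleton.elim (ρ g) 0]
    rw [this]
    exact zero_mem _
  have hbt : Nontrivial (Subrepresentation ρ) := by
    refine ⟨⊥, ⊤, fun h => ?_⟩
    have := congrArg Subrepresentation.toSubmodule h
    exact bot_ne_top this
  obtain ⟨p, hp⟩ : ∃ p : Subrepresentation ρ, ¬ (p = ⊥ ∨ p = ⊤) := by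
    by_contra! hcon
    exact hirr ⟨hcon⟩
  push Not at hp
  obtain ⟨q, hq⟩ := exists_isCompl p
  have hpq : IsCompl p.toSubmodule q.toSubmodule := by
    constructor
    · rw [disjoint_iff]
      exact congrArg Subrepresentation.toSubmodule hq.inf_eq_bot
    · rw [codisjoint_iff]
      exact congrArg Subrepresentation.toSubmodule hq.sup_eq_top
  have hp0 : p.toSubmodule ≠ ⊥ := fun h => hp.1 (Subrepresentation.toSubmodule_injective h)
  have hp1 : p.toSubmodule ≠ ⊤ := fun h => hp.2 (Subrepresentation.toSubmodule_injective h)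
  have hsum := Submodule.finrank_add_eq_of_isCompl hpq
  have h0 : 0 < Module.finrank ℂ p.toSubmodule := by
    rw [Nat.pos_iff_ne_zero]
    exact fun h => hp0 (Submodule.finrank_eq_zero.mp h)
  have h1 := Submodule.finrank_lt hp1
  rw [character_eq_add_of_isCompl hpq]
  exact add_mem (ih _ h1 _ rfl) (ih _ (by omega) _ rfl)

/-- The regular character is the character of the action of `G` on functions by translation. -/
theorem regChar_mem_closure [Finite G] :
    regChar G ∈ AddSubmonoid.closure {f : G → ℂ | IsIrrChar G f} := by
  classical
  have := Fintype.ofFinite G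
  let ρ : Representation ℂ G (G → ℂ) :=
    { toFun := fun g => LinearMap.funLeft ℂ ℂ (fun x => x * g)
      map_one' := by ext; simp [LinearMap.funLeft]
      map_mul' := fun g h => by ext; simp [LinearMap.funLeft, mul_assoc] }
  have h : ρ.character = regChar G := by
    ext g
    rw [Representation.character, LinearMap.trace_eq_matrix_trace ℂ (Pi.basisFun ℂ G)]
    simp [Matrix.trace, ρ, LinearMap.funLeft_apply, Pi.single_apply,
      regChar]
  exact h ▸ character_mem_closure ρ

variable [Fintype G]

/-- The bilinear form on functions on `G` for which irreducible characters are orthonormal. -/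
noncomputable def charInner (f g : G → ℂ) : ℂ := (Nat.card G : ℂ)⁻¹ * ∑ x, f x * g x⁻¹

theorem charInner_add_left (f₁ f₂ g : G → ℂ) :
    charInner (f₁ + f₂) g = charInner f₁ g + charInner f₂ g := by
  simp [charInner, add_mul, Finset.sum_add_distrib, mul_add]

theorem charInner_zero_left (g : G → ℂ) : charInner 0 g = 0 := by
  simp [charInner]

theorem charInner_regChar (f : G → ℂ) : charInner (regChar G) f = f 1 := by
  classical
  simp [charInner, regChar]

open Classical in
theorem IsIrrChar.charInner_eq {χ ψ : G → ℂ} (hχ : IsIrrChar G χ) (hψ : IsIrrChar G ψ) :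
    charInner χ ψ = if χ = ψ then 1 else 0 := by
  have hG : (Nat.card G : ℂ) ≠ 0 := NeZero.ne _
  have := invertibleOfNonzero hG
  obtain ⟨V, hV, rfl⟩ := hχ
  obtain ⟨W, hW, rfl⟩ := hψ
  by_cases h : V.character = W.character
  · have := FDRep.char_orthonormal V V
    rw [if_pos ⟨Iso.refl V⟩] at this
    rw [if_pos h, ← h, charInner, this]
  · rw [if_neg h, charInner, FDRep.char_orthonormal, if_neg]
    exact fun ⟨i⟩ => h (FDRep.char_iso i)

theorem IsIrrChar.of_charInner_self {V : Type} [AddCommGroup V] [Module ℂ V]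
    [FiniteDimensional ℂ V] (ρ : Representation ℂ G V)
    (h : charInner ρ.character ρ.character = 1) : IsIrrChar G ρ.character := by
  refine ⟨FDRep.of ρ, ?_, rfl⟩
  rw [FDRep.simple_iff_char_is_norm_one]
  rw [charInner, inv_mul_eq_one₀ (NeZero.ne _)] at h
  exact h.symm

open Classical in
theorem charInner_multiset_sum {M : Multiset (G → ℂ)} (hM : ∀ ψ ∈ M, IsIrrChar G ψ) {χ : G → ℂ}
    (hχ : IsIrrChar G χ) : charInner M.sum χ = M.count χ := by
  induction M using Multiset.induction_on with
  | empty => simp [charInner_zero_left]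
  | cons ψ M ih =>
    rw [Multiset.sum_cons, charInner_add_left, ih fun φ hφ => hM φ (Multiset.mem_cons_of_mem hφ),
      (hM ψ (Multiset.mem_cons_self ψ M)).charInner_eq hχ, Multiset.count_cons]
    simp only [eq_comm (a := ψ)]
    split_ifs <;> simp [add_comm]

theorem IsIrrChar.apply_one_ne_zero {χ : G → ℂ} (hχ : IsIrrChar G χ) : χ 1 ≠ 0 := by
  have h := hχ.charInner_eq hχ
  obtain ⟨V, hV, rfl⟩ := hχ
  intro h1
  rw [FDRep.char_one, Nat.cast_eq_zero, Module.finrank_zero_iff] at h1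
  have : V.character = 0 := by
    ext g
    simp [FDRep.character, Subsingleton.elim (V.ρ g) 0]
  rw [this, charInner_zero_left] at h
  simp at h

theorem finite_setOf_isIrrChar : {χ : G → ℂ | IsIrrChar G χ}.Finite := by
  classical
  obtain ⟨M, hM, hsum⟩ := AddSubmonoid.exists_multiset_of_mem_closure (regChar_mem_closure (G := G))
  refine M.toFinset.finite_toSet.subset fun χ hχ => ?_
  have h := charInner_multiset_sum hM hχ
  rw [hsum, charInner_regChar] at h
  rw [Finset.mem_coe, Multiset.mem_toFinset]
  by_contra hcon
  rw [Multiset.count_eq_zero_of_notMem hcon] at h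
  exact hχ.apply_one_ne_zero (by simpa using h)

/-- The irreducible characters of a finite group. -/
noncomputable def irrChars (G : Type) [Group G] [Fintype G] : Finset (G → ℂ) :=
  (finite_setOf_isIrrChar (G := G)).toFinset

@[simp]
theorem mem_irrChars {χ : G → ℂ} : χ ∈ irrChars G ↔ IsIrrChar G χ := by
  simp [irrChars]

/-- A character is the sum of the irreducible characters with their multiplicities. -/
theorem eq_sum_charInner {f : G → ℂ} (hf : f ∈ AddSubmonoid.closure {f : G → ℂ | IsIrrChar G f}) :
    ∃ m : (G → ℂ) → ℕ, f = ∑ ψ ∈ irrChars G, m ψ • ψ ∧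
      ∀ ψ ∈ irrChars G, (m ψ : ℂ) = charInner f ψ := by
  classical
  obtain ⟨M, hM, rfl⟩ := AddSubmonoid.exists_multiset_of_mem_closure hf
  refine ⟨fun ψ => M.count ψ, ?_, fun ψ hψ => ?_⟩
  · rw [Finset.sum_multiset_count]
    refine Finset.sum_subset (fun ψ hψ => ?_) fun ψ _ hψ => ?_
    · exact mem_irrChars.mpr (hM ψ (Multiset.mem_toFinset.mp hψ))
    · rw [Multiset.count_eq_zero_of_notMem (fun h => hψ (Multiset.mem_toFinset.mpr h)), zero_smul]
  · exact (charInner_multiset_sum hM (mem_irrChars.mp hψ)).symm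

theorem regChar_eq_sum : regChar G = ∑ ψ ∈ irrChars G, ψ 1 • ψ := by
  obtain ⟨m, hm, hmc⟩ := eq_sum_charInner (regChar_mem_closure (G := G))
  rw [hm]
  refine Finset.sum_congr rfl fun ψ hψ => ?_
  rw [← Nat.cast_smul_eq_nsmul ℂ, hmc ψ hψ, charInner_regChar]

omit [Fintype G] in
theorem IsIrrChar.isVirtualChar {χ : G → ℂ} (hχ : IsIrrChar G χ) : IsVirtualChar G χ :=
  Submodule.subset_span (s := {f : G → ℂ | IsIrrChar G f}) hχ

theorem isVirtualChar_regChar : IsVirtualChar G (regChar G) := by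
  obtain ⟨m, hm, -⟩ := eq_sum_charInner (regChar_mem_closure (G := G))
  rw [hm]
  change _ ∈ Submodule.span ℤ {f : G → ℂ | IsIrrChar G f}
  exact sum_mem fun ψ hψ => nsmul_mem (mem_irrChars.mp hψ).isVirtualChar _

omit [Fintype G] in
theorem mul_regChar (χ : G → ℂ) : χ * regChar G = χ 1 • regChar G := by
  ext g
  by_cases h : g = 1 <;> simp [regChar, h]

/-- The linear character attached to a homomorphism to the units of `ℂ`. -/
def linChar (l : G →* ℂˣ) : G → ℂ := fun g => (l g : ℂ)

omit [Fintype G] in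
@[simp]
theorem linChar_apply_one (l : G →* ℂˣ) : linChar l 1 = 1 := by
  simp [linChar]

omit [Fintype G] in
theorem linChar_mul (l l' : G →* ℂˣ) : linChar (l * l') = linChar l * linChar l' := by
  ext g
  simp [linChar]

omit [Fintype G] in
theorem linChar_injective : Function.Injective (linChar (G := G)) := by
  intro l l' h
  ext g
  exact congrFun h g

omit [Fintype G] in
theorem linChar_mul_linChar_inv (l : G →* ℂˣ) (g : G) : linChar l g * linChar l g⁻¹ = 1 := by
  simp [linChar]

/-- The product of an irreducible character and a linear character is irreducible. -/
theorem IsIrrChar.linChar_mul {χ : G → ℂ} (hχ : IsIrrChar G χ) (l : G →* ℂˣ) :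
    IsIrrChar G (linChar l * χ) := by
  have h := hχ.charInner_eq hχ
  rw [if_pos rfl] at h
  obtain ⟨V, hV, rfl⟩ := hχ
  let ρ : Representation ℂ G V :=
    { toFun := fun g => (l g : ℂ) • V.ρ g
      map_one' := by simp
      map_mul' := fun g g' => by
        rw [map_mul, map_mul, Units.val_mul, smul_mul_smul_comm] }
  have hρ : ρ.character = linChar l * V.character := by
    ext g
    simp [Representation.character, ρ, linChar, FDRep.character]
  rw [← hρ]
  refine IsIrrChar.of_charInner_self ρ ?_
  rw [hρ, ← h, charInner, charInner]
  congr 1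
  refine Finset.sum_congr rfl fun g _ => ?_
  rw [Pi.mul_apply, Pi.mul_apply, mul_mul_mul_comm, linChar_mul_linChar_inv, one_mul]

theorem isIrrChar_linChar (l : G →* ℂˣ) : IsIrrChar G (linChar l) := by
  let ρ : Representation ℂ G ℂ :=
    { toFun := fun g => (l g : ℂ) • LinearMap.id
      map_one' := by simp; rfl
      map_mul' := fun g g' => by ext; simp [mul_comm] }
  have hρ : ρ.character = linChar l := by
    ext g
    simp [Representation.character, ρ, linChar]
  rw [← hρ]
  refine IsIrrChar.of_charInner_self ρ ?_
  rw [hρ, charInner]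
  simp [linChar_mul_linChar_inv]

instance : Finite (G →* ℂˣ) :=
  have : Finite {χ : G → ℂ // IsIrrChar G χ} := (finite_setOf_isIrrChar (G := G)).to_subtype
  Finite.of_injective (fun l => (⟨linChar l, isIrrChar_linChar l⟩ : {χ // IsIrrChar G χ}))
    fun _ _ h => linChar_injective (congrArg Subtype.val h)

omit [Fintype G] in
theorem IsIrrChar.exists_eq_linChar {χ : G → ℂ} (hχ : IsIrrChar G χ) (h1 : χ 1 = 1) :
    ∃ l : G →* ℂˣ, χ = linChar l := by
  obtain ⟨V, hV, rfl⟩ := hχ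
  rw [FDRep.char_one, Nat.cast_eq_one] at h1
  have hdet : ∀ g, V.character g = LinearMap.det (V.ρ g) := fun g => by
    obtain ⟨c, hc, -⟩ := LinearMap.existsUnique_eq_smul_id_of_finrank_eq_one h1 (V.ρ g)
    simp [FDRep.character, hc, h1]
  refine ⟨MonoidHom.toHomUnits ((LinearMap.det).comp V.ρ), ?_⟩
  ext g
  simp [linChar, hdet]

/-- The homomorphisms to the units of `ℂ` fixing a given function under multiplication. -/
def linStabilizer (χ : G → ℂ) : Subgroup (G →* ℂˣ) where
  carrier := {l | linChar l * χ = χ}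
  one_mem' := by ext; simp [linChar]
  mul_mem' {l l'} hl hl' := by
    rw [Set.mem_ofPred_eq] at hl hl' ⊢
    rw [linChar_mul, mul_assoc, hl', hl]
  inv_mem' {l} hl := by
    rw [Set.mem_ofPred_eq] at hl ⊢
    nth_rewrite 1 [← hl]
    ext g
    simp [linChar]

/-- Summing `linChar l * χ` over representatives modulo the stabilizer and multiplying by the order
of the stabilizer gives the sum over all `l`. -/
theorem sum_linChar_mul_eq_card_smul [Fintype (G →* ℂˣ)] (χ : G → ℂ)
    [Fintype ((G →* ℂˣ) ⧸ linStabilizer χ)] :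
    ∑ l : G →* ℂˣ, linChar l * χ =
      Nat.card (linStabilizer χ) •
        ∑ q : (G →* ℂˣ) ⧸ linStabilizer χ, linChar (Quotient.out q) * χ := by
  have := Fintype.ofFinite (linStabilizer χ)
  let F : ((G →* ℂˣ) ⧸ linStabilizer χ) × linStabilizer χ → (G →* ℂˣ) :=
    fun p => Quotient.out p.1 * p.2
  have hmk : ∀ p, (QuotientGroup.mk (F p) : (G →* ℂˣ) ⧸ linStabilizer χ) = p.1 := fun p => by
    rw [QuotientGroup.mk_mul_of_mem _ p.2.2, QuotientGroup.out_eq']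
  have hF : Function.Bijective F := by
    refine ⟨fun p p' h => ?_, fun l => ?_⟩
    · have h1 : p.1 = p'.1 := by rw [← hmk p, h, hmk p']
      refine Prod.ext h1 (Subtype.ext ?_)
      simpa [F, h1] using h
    · let q : (G →* ℂˣ) ⧸ linStabilizer χ := QuotientGroup.mk l
      refine ⟨(q, ⟨(Quotient.out q)⁻¹ * l, ?_⟩), ?_⟩
      · exact QuotientGroup.eq.mp (QuotientGroup.out_eq' _)
      · exact mul_inv_cancel_left (Quotient.out q) l
  have h : ∀ p, linChar (F p) * χ = linChar (Quotient.out p.1) * χ := fun p => by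
    rw [linChar_mul, mul_assoc, show linChar (p.2 : G →* ℂˣ) * χ = χ from p.2.2]
  rw [← hF.sum_comp, Finset.sum_congr rfl fun p _ => h p, Fintype.sum_prod_type, Finset.smul_sum]
  simp [Nat.card_eq_fintype_card]

/-- When the degrees are `1` and `n ≠ 1`, a sum over the irreducible characters splits into a sum
over the linear characters and a sum over those of degree `n`. -/
theorem sum_irrChars_eq {n : ℕ} (hn : n ≠ 1)
    (hdeg : ∀ χ : G → ℂ, IsIrrChar G χ → χ 1 = 1 ∨ χ 1 = (n : ℂ)) [Fintype (G →* ℂˣ)]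
    {A : Type} [AddCommMonoid A] (F : (G → ℂ) → A) :
    ∑ ψ ∈ irrChars G, F ψ =
      ∑ l : G →* ℂˣ, F (linChar l) + ∑ ψ ∈ irrChars G with ψ 1 = (n : ℂ), F ψ := by
  classical
  rw [← Finset.sum_filter_add_sum_filter_not (irrChars G) (fun ψ => ψ 1 = (n : ℂ)), add_comm]
  congr 1
  symm
  refine Finset.sum_bij (fun l _ => linChar l) (fun l _ => ?_)
    (fun _ _ _ _ h => linChar_injective h) (fun ψ hψ => ?_) fun _ _ => rfl
  · simpa [isIrrChar_linChar] using Ne.symm (Nat.cast_ne_one.mpr hn)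
  · rw [Finset.mem_filter, mem_irrChars] at hψ
    obtain ⟨l, rfl⟩ := hψ.1.exists_eq_linChar ((hdeg ψ hψ.1).resolve_right hψ.2)
    exact ⟨l, Finset.mem_univ l, rfl⟩

/-- The degree `n` divides the order of the stabilizer of a character `χ` of degree `n`, by
counting the degrees of the constituents of `χ * χ̄`. -/
theorem IsIrrChar.dvd_card_linStabilizer {n : ℕ} (hn : n ≠ 1)
    (hdeg : ∀ χ : G → ℂ, IsIrrChar G χ → χ 1 = 1 ∨ χ 1 = (n : ℂ))
    {χ : G → ℂ} (hχ : IsIrrChar G χ) (hχn : χ 1 = n) : n ∣ Nat.card (linStabilizer χ) := by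
  classical
  have := Fintype.ofFinite (G →* ℂˣ)
  have hmem : (fun g => χ g * χ g⁻¹) ∈ AddSubmonoid.closure {f : G → ℂ | IsIrrChar G f} := by
    obtain ⟨V, hV, rfl⟩ := hχ
    convert Representation.character_mem_closure (Representation.linHom V.ρ V.ρ) using 1
    ext g
    rw [Representation.char_linHom, mul_comm]
    rfl
  obtain ⟨m, hm, hmc⟩ := eq_sum_charInner hmem
  have hlin : ∀ l : G →* ℂˣ, m (linChar l) = if l ∈ linStabilizer χ then 1 else 0 := fun l => by
    have h : charInner (fun g => χ g * χ g⁻¹) (linChar l) = charInner χ (linChar l * χ) := by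
      simp only [charInner, Pi.mul_apply]
      congr 1
      exact Finset.sum_congr rfl fun g _ => by ring
    have h' := hmc _ (mem_irrChars.mpr (isIrrChar_linChar l))
    rw [h, hχ.charInner_eq (hχ.linChar_mul l)] at h'
    have hiff : l ∈ linStabilizer χ ↔ χ = linChar l * χ := eq_comm
    simp only [hiff]
    exact_mod_cast h'
  have hval := congrFun hm 1
  rw [sum_irrChars_eq hn hdeg] at hval
  simp only [hlin, Pi.add_apply, Finset.sum_apply, Pi.smul_apply, inv_one, hχn,
    linChar_apply_one] at hval
  rw [Finset.sum_congr rfl (g := fun ψ => m ψ • (n : ℂ))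
    (fun ψ hψ => by rw [(Finset.mem_filter.mp hψ).2])] at hval
  have hcard : ∑ l : G →* ℂˣ, (if l ∈ linStabilizer χ then 1 else 0 : ℕ) • (1 : ℂ) =
      (Nat.card (linStabilizer χ) : ℂ) := by
    have : Nat.card (linStabilizer χ) = Fintype.card {l // l ∈ linStabilizer χ} :=
      Nat.card_eq_fintype_card
    rw [this, Fintype.card_subtype]
    simp
  rw [hcard, ← Finset.sum_smul, nsmul_eq_mul] at hval
  have hnat : n * n =
      Nat.card (linStabilizer χ) + (∑ ψ ∈ irrChars G with ψ 1 = (n : ℂ), m ψ) * n := by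
    exact_mod_cast hval
  exact (Nat.dvd_add_left (dvd_mul_left n _)).mp (hnat ▸ dvd_mul_left n n)

end Characters

/-- If all irreducible characters of a finite group `G` have degree
`1` or degree `n` for a fixed `n > 0`, then `G` is of Knutson type. -/
theorem two_degrees_isKnutsonType (G : Type) [Group G] [Finite G]
    (h : ∃ n : ℕ, 0 < n ∧
      ∀ χ : G → ℂ, IsIrrChar G χ → χ 1 = 1 ∨ χ 1 = (n : ℂ)) :
    IsKnutsonType G := by
  classical
  have := Fintype.ofFinite G
  have := Fintype.ofFinite (G →* ℂˣ)
  obtain ⟨n, hn, hdeg⟩ := h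
  intro χ hχ
  by_cases hχ1 : χ 1 = 1
  · exact ⟨regChar G, isVirtualChar_regChar, by rw [mul_regChar, hχ1, one_smul]⟩
  have hχn := (hdeg χ hχ).resolve_left hχ1
  have hn1 : n ≠ 1 := fun h => hχ1 (by rw [hχn, h, Nat.cast_one])
  have := Fintype.ofFinite ((G →* ℂˣ) ⧸ linStabilizer χ)
  obtain ⟨k, hk⟩ := hχ.dvd_card_linStabilizer hn1 hdeg hχn
  have horbit := sum_linChar_mul_eq_card_smul χ
  have hreg := regChar_eq_sum (G := G)
  have hbig : ∑ ψ ∈ irrChars G with ψ 1 = (n : ℂ), ψ 1 • ψ =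
      (n : ℂ) • ∑ ψ ∈ irrChars G with ψ 1 = (n : ℂ), ψ := by
    rw [Finset.smul_sum]
    exact Finset.sum_congr rfl fun ψ hψ => by rw [(Finset.mem_filter.mp hψ).2]
  rw [sum_irrChars_eq hn1 hdeg, hbig] at hreg
  rw [← Finset.sum_mul, ← Finset.sum_mul, hk] at horbit
  simp only [linChar_apply_one, one_smul] at hreg
  refine ⟨∑ ψ ∈ irrChars G with ψ 1 = (n : ℂ), ψ +
    k • ∑ q : (G →* ℂˣ) ⧸ linStabilizer χ, linChar (Quotient.out q), ?_, ?_⟩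
  · change _ ∈ Submodule.span ℤ {f : G → ℂ | IsIrrChar G f}
    refine add_mem (sum_mem fun ψ hψ => ?_) (nsmul_mem (sum_mem fun q _ => ?_) _)
    · exact (mem_irrChars.mp (Finset.mem_filter.mp hψ).1).isVirtualChar
    · exact (isIrrChar_linChar _).isVirtualChar
  · have hmul := mul_regChar χ
    rw [hχn] at hmul
    generalize (∑ ψ ∈ irrChars G with ψ 1 = (n : ℂ), ψ) = P at *
    generalize (∑ q : (G →* ℂˣ) ⧸ linStabilizer χ, linChar (Quotient.out q)) = Q at *
    generalize (∑ l : G →* ℂˣ, linChar l) = L at *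
    ext g
    have e1 := congrFun horbit g
    have e2 := congrFun hreg g
    have e3 := congrFun hmul g
    simp only [Pi.mul_apply, Pi.add_apply, Pi.smul_apply, smul_eq_mul, nsmul_eq_mul,
      Nat.cast_mul] at e1 e2 e3 ⊢
    have hn0 : (n : ℂ) ≠ 0 := Nat.cast_ne_zero.mpr hn.ne'
    refine mul_left_cancel₀ hn0 ?_
    linear_combination e3 - e1 - χ g * e2
end
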